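/- arXiv:2104.12368 — 2 statements merged into one kernel-verified Lean document; each statement's English description precedes it below -/
import Mathlib

section
/- Let T be a σ-compact metric space, ν a Borel probability measure on T, and K¹,K²: T×T→ℝ continuous symmetric positive definite kernels with ∫_T K^i(x,x) dν(x) ≤ κ_i² for constants κ_1,κ_2 > 0. Then for each i,j ∈ {1,2}, the cross-covariance operator R_{ij} = ∫_T K^i_t ⊗ K^j_t dν(t) : H_{K^j} → H_{K^i} is a Hilbert–Schmidt operator, with ‖R_{ij}‖_{HS(H_{K^j},H_{K^i})} ≤ κ_i κ_j. -/
/- STATEMENT 0: `T` σ-compact metric space, `ν` Borel probability measure, `K⁰,K¹` (indexed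
by `Fin 2`) continuous symmetric positive definite kernels with `∫ K^i(x,x) dν ≤ κ_i²`.
Each RKHS `H_{K^i}` is encoded by a Hilbert space `H i` with feature map `Φ i : T → H i`
satisfying `⟪Φ i s, Φ i t⟫ = K^i(s,t)` and having dense span.  The cross-covariance operator
`R i j = ∫_T K^i_t ⊗ K^j_t dν(t) : H j → H i` is characterized by
`R i j f = ∫ ⟪Φ j t, f⟫ • Φ i t dν(t)`.  Conclusion: each `R i j` is Hilbert–Schmidt with
`‖R i j‖_{HS} ≤ κ_i κ_j`, where the HS norm is computed along a Hilbert basis `e j` of `H j`: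
`‖A‖²_HS = ∑' k, ‖A (e j k)‖²`, HS-ness being summability of this family. -/

open MeasureTheory
open scoped RealInnerProductSpace

noncomputable section

/-- A feature map whose kernel is continuous is continuous. -/
theorem continuous_of_continuous_inner {T E : Type*} [TopologicalSpace T]
    [NormedAddCommGroup E] [InnerProductSpace ℝ E] {φ : T → E}
    (h : Continuous fun p : T × T => ⟪φ p.1, φ p.2⟫) : Continuous φ := by
  rw [continuous_iff_continuousAt]
  intro t
  rw [ContinuousAt, tendsto_iff_norm_sub_tendsto_zero]
  have hc : Continuous fun s => √(⟪φ s, φ s⟫ - 2 * ⟪φ s, φ t⟫ + ⟪φ t, φ t⟫) :=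
    (((h.comp (continuous_id.prodMk continuous_id)).sub
      (continuous_const.mul (h.comp (continuous_id.prodMk continuous_const)))).add
        continuous_const).sqrt
  have hs : ∀ s, ‖φ s - φ t‖ = √(⟪φ s, φ s⟫ - 2 * ⟪φ s, φ t⟫ + ⟪φ t, φ t⟫) := fun s => by
    rw [real_inner_self_eq_norm_sq, real_inner_self_eq_norm_sq, ← norm_sub_sq_real,
      Real.sqrt_sq (norm_nonneg _)]
  have h0 := hc.tendsto t
  simp only [← hs, sub_self, norm_zero] at h0
  exact h0

/-- Cauchy-Schwarz inequality for the norm of a Bochner integral `∫ g • φ`. -/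
theorem norm_integral_smul_sq_le {T E : Type*} [MeasurableSpace T] {ν : Measure T}
    [NormedAddCommGroup E] [NormedSpace ℝ E] {g : T → ℝ} {φ : T → E}
    (hg : MemLp g 2 ν) (hφ : MemLp φ 2 ν) :
    ‖∫ t, g t • φ t ∂ν‖ ^ 2 ≤ (∫ t, g t ^ 2 ∂ν) * ∫ t, ‖φ t‖ ^ 2 ∂ν := by
  have h1 : ‖∫ t, g t • φ t ∂ν‖ ≤ ∫ t, ‖g t‖ * ‖φ t‖ ∂ν := by
    simpa only [norm_smul] using norm_integral_le_integral_norm (μ := ν) fun t => g t • φ t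
  have h2 := integral_mul_le_Lp_mul_Lq_of_nonneg (μ := ν) Real.HolderConjugate.two_two
    (f := fun t => ‖g t‖) (g := fun t => ‖φ t‖)
    (.of_forall fun _ => norm_nonneg _) (.of_forall fun _ => norm_nonneg _)
    (by simpa using hg.norm) (by simpa using hφ.norm)
  simp only [Real.rpow_two, ← Real.sqrt_eq_rpow, Real.norm_eq_abs, sq_abs] at h1 h2
  have hA : 0 ≤ ∫ t, g t ^ 2 ∂ν := integral_nonneg fun _ => sq_nonneg _
  have hB : 0 ≤ ∫ t, ‖φ t‖ ^ 2 ∂ν := integral_nonneg fun _ => sq_nonneg _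
  calc ‖∫ t, g t • φ t ∂ν‖ ^ 2
      ≤ (√(∫ t, g t ^ 2 ∂ν) * √(∫ t, ‖φ t‖ ^ 2 ∂ν)) ^ 2 :=
        pow_le_pow_left₀ (norm_nonneg _) (h1.trans h2) 2
    _ = _ := by rw [mul_pow, Real.sq_sqrt hA, Real.sq_sqrt hB]

/-- Bessel's inequality integrated along a square-integrable map. -/
theorem sum_integral_inner_sq_le {T E ι : Type*} [MeasurableSpace T] {ν : Measure T}
    [NormedAddCommGroup E] [InnerProductSpace ℝ E] {φ : T → E} (hφ : MemLp φ 2 ν)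
    {e : ι → E} (he : Orthonormal ℝ e) (S : Finset ι) :
    ∑ k ∈ S, ∫ t, ⟪φ t, e k⟫ ^ 2 ∂ν ≤ ∫ t, ‖φ t‖ ^ 2 ∂ν := by
  have hint : ∀ k ∈ S, Integrable (fun t => ⟪φ t, e k⟫ ^ 2) ν := fun k _ =>
    (hφ.inner_const (𝕜 := ℝ) (e k)).integrable_sq
  rw [← integral_finsetSum S hint]
  refine integral_mono (integrable_finsetSum S hint) hφ.norm.integrable_sq fun t => ?_
  have h := he.sum_inner_products_le (φ t) (s := S)
  simpa only [Real.norm_eq_abs, sq_abs, real_inner_comm] using h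

theorem crossCovariance_hilbertSchmidt
    {T : Type*} [MetricSpace T] [SigmaCompactSpace T] [MeasurableSpace T] [BorelSpace T]
    (ν : Measure T) [IsProbabilityMeasure ν]
    (K : Fin 2 → T → T → ℝ)
    (hKcont : ∀ i, Continuous fun p : T × T => K i p.1 p.2)
    (hKsymm : ∀ i s t, K i s t = K i t s)
    (hKpos : ∀ i (n : ℕ) (x : Fin n → T) (c : Fin n → ℝ),
      0 ≤ ∑ a, ∑ b, c a * c b * K i (x a) (x b))
    (κ : Fin 2 → ℝ) (hκ : ∀ i, 0 < κ i)
    (hKint : ∀ i, Integrable (fun x => K i x x) ν)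
    (htr : ∀ i, ∫ x, K i x x ∂ν ≤ κ i ^ 2)
    (H : Fin 2 → Type*) [∀ i, NormedAddCommGroup (H i)] [∀ i, InnerProductSpace ℝ (H i)]
    [∀ i, CompleteSpace (H i)]
    (Φ : ∀ i, T → H i)
    (hΦ : ∀ i s t, ⟪Φ i s, Φ i t⟫ = K i s t)
    (hdense : ∀ i, (Submodule.span ℝ (Set.range (Φ i))).topologicalClosure = ⊤)
    (ι : Fin 2 → Type*) [∀ i, Countable (ι i)]
    (e : ∀ i, HilbertBasis (ι i) ℝ (H i))
    (R : ∀ i j, H j →L[ℝ] H i)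
    (hR : ∀ i j (f : H j), R i j f = ∫ t, ⟪Φ j t, f⟫ • Φ i t ∂ν) :
    ∀ i j, (Summable fun k => ‖R i j (e j k)‖ ^ 2) ∧
      Real.sqrt (∑' k, ‖R i j (e j k)‖ ^ 2) ≤ κ i * κ j := by
  intro i j
  have hnorm : ∀ i t, ‖Φ i t‖ ^ 2 = K i t t := fun i t => by
    rw [← real_inner_self_eq_norm_sq, hΦ]
  have hcont : ∀ i, Continuous (Φ i) := fun i =>
    continuous_of_continuous_inner (by simpa only [hΦ] using hKcont i)
  have hL : ∀ i, MemLp (Φ i) 2 ν := fun i => by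
    have hm : AEStronglyMeasurable (Φ i) ν := (hcont i).aestronglyMeasurable
    rw [memLp_two_iff_integrable_sq_norm hm]
    simpa only [hnorm] using hKint i
  have hB : ∀ i, ∫ t, ‖Φ i t‖ ^ 2 ∂ν ≤ κ i ^ 2 := fun i => by
    simpa only [hnorm] using htr i
  have hsum : ∀ S : Finset (ι j), ∑ k ∈ S, ‖R i j (e j k)‖ ^ 2 ≤ (κ i * κ j) ^ 2 := fun S =>
    calc ∑ k ∈ S, ‖R i j (e j k)‖ ^ 2
        ≤ ∑ k ∈ S, (∫ t, ⟪Φ j t, e j k⟫ ^ 2 ∂ν) * ∫ t, ‖Φ i t‖ ^ 2 ∂ν :=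
          Finset.sum_le_sum fun k _ => by
            rw [hR]
            exact norm_integral_smul_sq_le ((hL j).inner_const (𝕜 := ℝ) (e j k)) (hL i)
      _ = (∑ k ∈ S, ∫ t, ⟪Φ j t, e j k⟫ ^ 2 ∂ν) * ∫ t, ‖Φ i t‖ ^ 2 ∂ν :=
          (Finset.sum_mul ..).symm
      _ ≤ κ j ^ 2 * κ i ^ 2 :=
          mul_le_mul ((sum_integral_inner_sq_le (hL j) (e j).orthonormal S).trans (hB j)) (hB i)
            (integral_nonneg fun _ => sq_nonneg _) (sq_nonneg _)
      _ = (κ i * κ j) ^ 2 := by ring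
  refine ⟨summable_of_sum_le (fun _ => sq_nonneg _) hsum, ?_⟩
  exact Real.sqrt_le_iff.2 ⟨(mul_pos (hκ i) (hκ j)).le,
    Real.tsum_le_of_sum_le (fun _ => sq_nonneg _) hsum⟩

end
end

section
/- Let K be a continuous symmetric positive definite kernel on T with sup_{x∈T} K(x,x) ≤ κ², and let ξ be a centered Gaussian process on a probability space (Ω,ℱ,P) with covariance function K. Fix X = (x_1,…,x_m) ∈ T^m. Then ‖K[X]‖_F ≤ mκ². Moreover, if W = (ω_1,…,ω_N) is sampled independently from (Ω,P) and K̂_W[X] := (1/N) Σ_{j=1}^N z(ω_j) z(ω_j)^T with z(ω) := (ξ(ω,x_1),…,ξ(ω,x_m)) ∈ ℝ^m, then for every 0 < δ < 1, with probability at least 1−δ, both ‖K̂_W[X] − K[X]‖_F ≤ 2√3 · mκ²/(√N · δ) and ‖K̂_W[X]‖_F ≤ 2mκ²/δ. -/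
open MeasureTheory ProbabilityTheory

noncomputable section

theorem integral_sq_gaussianReal (v : NNReal) :
    ∫ x, x ^ 2 ∂gaussianReal 0 v = v := by
  have h := variance_of_integral_eq_zero (μ := gaussianReal 0 v) (X := fun x : ℝ => x)
    aemeasurable_id (by simp)
  rw [← h, variance_fun_id_gaussianReal]

theorem integral_pow_four_gaussianReal (v : NNReal) :
    ∫ x, x ^ 4 ∂gaussianReal 0 v = 3 * (v : ℝ) ^ 2 := by
  have h := iteratedDeriv_mgf_zero (μ := gaussianReal 0 v) (X := fun x : ℝ => x)
    (by simp [integrableExpSet_fun_id_gaussianReal]) 4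
  simp only [Pi.pow_apply] at h
  rw [← h, mgf_fun_id_gaussianReal]
  generalize (v : ℝ) = w
  have e (t : ℝ) : HasDerivAt (fun t : ℝ => Real.exp (w * t ^ 2 / 2))
      (w * t * Real.exp (w * t ^ 2 / 2)) t := by
    convert (((hasDerivAt_pow 2 t).const_mul w).div_const 2).exp using 1
    simp; ring
  have h1 : deriv (fun t : ℝ => Real.exp (w * t ^ 2 / 2)) =
      fun t => w * t * Real.exp (w * t ^ 2 / 2) := funext fun t => (e t).deriv
  have h2 : deriv (fun t : ℝ => w * t * Real.exp (w * t ^ 2 / 2)) =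
      fun t => (w + w ^ 2 * t ^ 2) * Real.exp (w * t ^ 2 / 2) := by
    funext t
    refine ((((hasDerivAt_id' t).const_mul w).mul (e t)).congr_deriv ?_).deriv
    ring
  have h3 : deriv (fun t : ℝ => (w + w ^ 2 * t ^ 2) * Real.exp (w * t ^ 2 / 2)) =
      fun t => (3 * w ^ 2 * t + w ^ 3 * t ^ 3) * Real.exp (w * t ^ 2 / 2) := by
    funext t
    refine (((((hasDerivAt_pow 2 t).const_mul (w ^ 2)).const_add w).mul (e t)).congr_deriv ?_).deriv
    push_cast; ring
  have h4 : deriv (fun t : ℝ => (3 * w ^ 2 * t + w ^ 3 * t ^ 3) * Real.exp (w * t ^ 2 / 2)) 0 =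
      3 * w ^ 2 := by
    refine (((((hasDerivAt_id' (0 : ℝ)).const_mul (3 * w ^ 2)).add
      ((hasDerivAt_pow 3 (0 : ℝ)).const_mul (w ^ 3))).mul (e 0)).congr_deriv ?_).deriv
    simp
  simp [iteratedDeriv_succ, h1, h2, h3, h4]

theorem integral_sub_sq_average_pi_le {Ω : Type*} [MeasurableSpace Ω] (P : Measure Ω)
    [IsProbabilityMeasure P] {N : ℕ} (hN : 0 < N) {Y : Ω → ℝ} (hY : MemLp Y 2 P) :
    Integrable (fun W : Fin N → Ω => ((N : ℝ)⁻¹ * ∑ j, Y (W j) - ∫ ω, Y ω ∂P) ^ 2)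
      (Measure.pi fun _ => P) ∧
    ∫ W : Fin N → Ω, ((N : ℝ)⁻¹ * ∑ j, Y (W j) - ∫ ω, Y ω ∂P) ^ 2 ∂(Measure.pi fun _ => P) ≤
      (N : ℝ)⁻¹ * ∫ ω, Y ω ^ 2 ∂P := by
  have hN' : (N : ℝ) ≠ 0 := by positivity
  have hYj (j : Fin N) : MemLp (fun W : Fin N → Ω => Y (W j)) 2 (Measure.pi fun _ => P) :=
    hY.comp_measurePreserving (measurePreserving_eval (fun _ : Fin N => P) j)
  have hS : MemLp (fun W : Fin N → Ω => (N : ℝ)⁻¹ * ∑ j, Y (W j)) 2 (Measure.pi fun _ => P) :=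
    (memLp_finsetSum _ fun j _ => hYj j).const_mul _
  have hmean : ∫ W : Fin N → Ω, (N : ℝ)⁻¹ * ∑ j, Y (W j) ∂(Measure.pi fun _ => P) =
      ∫ ω, Y ω ∂P := by
    rw [integral_const_mul, integral_finsetSum _ fun j _ => (hYj j).integrable one_le_two]
    simp_rw [integral_comp_eval (μ := fun _ : Fin N => P) hY.aestronglyMeasurable]
    simp [hN']
  refine ⟨(hS.sub (memLp_const _)).integrable_sq, ?_⟩
  have hvar := variance_eq_integral hS.aestronglyMeasurable.aemeasurable
  rw [hmean] at hvar
  rw [← hvar, variance_const_mul]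
  have hsum := variance_sum_pi (μ := fun _ : Fin N => P) (X := fun _ => Y) fun _ => hY
  have hfun : (∑ i : Fin N, fun ω : Fin N → Ω => Y (ω i)) = fun W => ∑ j, Y (W j) := by
    ext; simp
  rw [hfun] at hsum
  rw [hsum]
  have hle := variance_le_expectation_sq hY.aestronglyMeasurable
  simp only [Finset.sum_const, Finset.card_univ, Fintype.card_fin, nsmul_eq_mul]
  calc _ = (N : ℝ)⁻¹ * Var[Y; P] := by field_simp
    _ ≤ _ := by gcongr; exact hle

theorem sum_sq_gram_le_sum_diag_sq {m N : ℕ} (z : Fin N → Fin m → ℝ) {c : ℝ} :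
    ∑ a, ∑ b, (c * ∑ j, z j a * z j b) ^ 2 ≤ (∑ a, c * ∑ j, z j a * z j a) ^ 2 := by
  rw [sq (∑ a, _), Finset.sum_mul_sum]
  gcongr with a _ b _
  have := Finset.sum_mul_sq_le_sq_mul_sq Finset.univ (fun j => z j a) (fun j => z j b)
  simp only [← sq] at this ⊢
  nlinarith [mul_le_mul_of_nonneg_left this (sq_nonneg c)]

theorem ofReal_one_sub_le_measure_of_integral_le {Ω : Type*} [MeasurableSpace Ω] {μ : Measure Ω}
    [IsProbabilityMeasure μ] {F : Ω → ℝ} (hF : ∀ ω, 0 ≤ F ω) (hFi : Integrable F μ) {δ : ℝ}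
    (hδ : ∫ ω, F ω ∂μ ≤ δ) {s : Set Ω} (hs : ∀ ω, F ω < 1 → ω ∈ s) :
    ENNReal.ofReal (1 - δ) ≤ μ s := by
  have h := mul_meas_ge_le_integral_of_nonneg (ae_of_all μ hF) hFi 1
  have hsub : μ.real ({ω | 1 ≤ F ω}ᶜ) ≤ μ.real s :=
    measureReal_mono fun ω hω => hs ω (by simpa using hω)
  have hnull : NullMeasurableSet {ω | 1 ≤ F ω} μ :=
    nullMeasurableSet_le aemeasurable_const hFi.aemeasurable
  rw [measureReal_def, prob_compl_eq_one_sub₀ hnull,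
    ENNReal.toReal_sub_of_le prob_le_one ENNReal.one_ne_top, ENNReal.toReal_one,
    ← measureReal_def] at hsub
  exact ENNReal.ofReal_le_of_le_toReal (by rw [← measureReal_def]; linarith)

theorem empirical_second_moment_concentration {Ω : Type*} [MeasurableSpace Ω] (P : Measure Ω)
    [IsProbabilityMeasure P] {m N : ℕ} (hm : 0 < m) (hN : 0 < N) (z : Fin m → Ω → ℝ)
    (C : Fin m → Fin m → ℝ) {κ : ℝ} (hκ : 0 < κ) (hz : ∀ a, MemLp (z a) 4 P)
    (hC : ∀ a b, ∫ ω, z a ω * z b ω ∂P = C a b) (hCκ : ∀ a, C a a ≤ κ ^ 2)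
    (h4 : ∀ a, ∫ ω, z a ω ^ 4 ∂P ≤ 3 * κ ^ 4) {δ : ℝ} (hδ0 : 0 < δ) (hδ1 : δ < 1) :
    ENNReal.ofReal (1 - δ) ≤
      (Measure.pi fun _ : Fin N => P) {W : Fin N → Ω |
        Real.sqrt (∑ a, ∑ b, ((N : ℝ)⁻¹ * ∑ j, z a (W j) * z b (W j) - C a b) ^ 2) ≤
          2 * Real.sqrt 3 * m * κ ^ 2 / (Real.sqrt N * δ) ∧
        Real.sqrt (∑ a, ∑ b, ((N : ℝ)⁻¹ * ∑ j, z a (W j) * z b (W j)) ^ 2) ≤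
          2 * m * κ ^ 2 / δ } := by
  have hN' : (0 : ℝ) < N := by positivity
  have hm' : (0 : ℝ) < m := by positivity
  have hprod (a b : Fin m) : MemLp (fun ω => z a ω * z b ω) 2 P := by
    have : ENNReal.HolderTriple 4 4 2 := ⟨by
      rw [← two_mul, show (4 : ENNReal) = 2 * 2 by norm_num,
        ENNReal.mul_inv (by simp) (by simp), ← mul_assoc,
        ENNReal.mul_inv_cancel (by simp) (by simp), one_mul]⟩
    exact (hz b).mul (hz a)
  have hz4 (a : Fin m) : Integrable (fun ω => z a ω ^ 4) P := by
    convert (hprod a a).integrable_sq using 2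
    ring
  have hprodsq (a b : Fin m) : ∫ ω, (z a ω * z b ω) ^ 2 ∂P ≤ 3 * κ ^ 4 := by
    calc _ ≤ ∫ ω, 2⁻¹ * (z a ω ^ 4 + z b ω ^ 4) ∂P :=
          integral_mono (hprod a b).integrable_sq (((hz4 a).add (hz4 b)).const_mul _)
            fun ω => by nlinarith [sq_nonneg (z a ω ^ 2 - z b ω ^ 2)]
      _ ≤ 3 * κ ^ 4 := by
          rw [integral_const_mul, integral_add (hz4 a) (hz4 b)]
          linarith [h4 a, h4 b]
  have hvar (a b : Fin m) := integral_sub_sq_average_pi_le P hN (hprod a b)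
  simp only [hC] at hvar
  set D : (Fin N → Ω) → ℝ := fun W =>
    ∑ a, ∑ b, ((N : ℝ)⁻¹ * ∑ j, z a (W j) * z b (W j) - C a b) ^ 2 with hD
  set R : (Fin N → Ω) → ℝ := fun W => ∑ a, (N : ℝ)⁻¹ * ∑ j, z a (W j) * z a (W j) with hR
  have hDi : Integrable D (Measure.pi fun _ => P) :=
    integrable_finsetSum _ fun a _ => integrable_finsetSum _ fun b _ => (hvar a b).1
  have hDint : ∫ W, D W ∂(Measure.pi fun _ => P) ≤ (N : ℝ)⁻¹ * (m ^ 2 * (3 * κ ^ 4)) := by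
    rw [hD, integral_finsetSum _ fun a _ => integrable_finsetSum _ fun b _ => (hvar a b).1]
    simp_rw [integral_finsetSum Finset.univ fun b _ => (hvar _ b).1]
    calc _ ≤ ∑ _a : Fin m, ∑ _b : Fin m, (N : ℝ)⁻¹ * (3 * κ ^ 4) := by
          gcongr with a _ b _
          exact (hvar a b).2.trans (by gcongr; exact hprodsq a b)
      _ = _ := by simp; ring
  have hji (a : Fin m) (j : Fin N) :
      Integrable (fun W : Fin N → Ω => z a (W j) * z a (W j)) (Measure.pi fun _ => P) :=
    (measurePreserving_eval (fun _ : Fin N => P) j).integrable_comp_of_integrable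
      ((hprod a a).integrable one_le_two)
  have hai (a : Fin m) : Integrable (fun W : Fin N → Ω =>
      (N : ℝ)⁻¹ * ∑ j, z a (W j) * z a (W j)) (Measure.pi fun _ => P) :=
    (integrable_finsetSum _ fun j _ => hji a j).const_mul _
  have hRi : Integrable R (Measure.pi fun _ => P) := integrable_finsetSum _ fun a _ => hai a
  have hRint : ∫ W, R W ∂(Measure.pi fun _ => P) ≤ m * κ ^ 2 := by
    rw [hR, integral_finsetSum _ fun a _ => hai a]
    calc _ ≤ ∑ _a : Fin m, κ ^ 2 := by
          gcongr with a _
          rw [integral_const_mul, integral_finsetSum _ fun j _ => hji a j]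
          simp_rw [integral_comp_eval (μ := fun _ : Fin N => P)
            (f := fun ω => z a ω * z a ω) (hprod a a).aestronglyMeasurable, hC]
          simpa [hN'.ne'] using hCκ a
      _ = _ := by simp
  have hD0 (W) : 0 ≤ D W := by positivity
  have hR0 (W) : 0 ≤ R W := by
    simp only [hR, ← sq]; positivity
  set c₁ : ℝ := 2 * Real.sqrt 3 * m * κ ^ 2 / (Real.sqrt N * δ) with hc₁
  set c₂ : ℝ := 2 * m * κ ^ 2 / δ with hc₂
  have hc₁0 : 0 < c₁ := by positivity
  have hc₂0 : 0 < c₂ := by positivity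
  have hc₁sq : c₁ ^ 2 = 12 * m ^ 2 * κ ^ 4 / (N * δ ^ 2) := by
    rw [hc₁, div_pow, mul_pow, mul_pow, mul_pow, mul_pow, Real.sq_sqrt (by norm_num),
      Real.sq_sqrt hN'.le]
    ring
  refine ofReal_one_sub_le_measure_of_integral_le (F := fun W => D W / c₁ ^ 2 + R W / c₂)
    (fun W => add_nonneg (div_nonneg (hD0 W) (by positivity)) (div_nonneg (hR0 W) hc₂0.le))
    ((hDi.div_const _).add (hRi.div_const _)) ?_ ?_
  · rw [integral_add (hDi.div_const _) (hRi.div_const _), integral_div, integral_div]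
    have e1 : (∫ W, D W ∂(Measure.pi fun _ => P)) / c₁ ^ 2 ≤ δ ^ 2 / 4 := by
      rw [div_le_iff₀ (by positivity), hc₁sq]
      refine hDint.trans (le_of_eq ?_)
      field_simp
      ring
    have e2 : (∫ W, R W ∂(Measure.pi fun _ => P)) / c₂ ≤ δ / 2 := by
      rw [div_le_iff₀ hc₂0, hc₂]
      refine hRint.trans (le_of_eq ?_)
      field_simp
    nlinarith
  · intro W hW
    have d1 : 0 ≤ D W / c₁ ^ 2 := div_nonneg (hD0 W) (by positivity)
    have d2 : 0 ≤ R W / c₂ := div_nonneg (hR0 W) hc₂0.le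
    constructor
    · refine Real.sqrt_le_iff.2 ⟨hc₁0.le, ?_⟩
      exact ((div_lt_one (by positivity)).1 (by linarith)).le
    · refine (Real.sqrt_le_sqrt
        (sum_sq_gram_le_sum_diag_sq (fun j a => z a (W j)) (c := (N : ℝ)⁻¹))).trans ?_
      rw [Real.sqrt_sq (hR0 W)]
      exact ((div_lt_one hc₂0).1 (by linarith)).le

theorem empirical_covariance_matrix_concentration
    {T : Type*} [MetricSpace T] [SigmaCompactSpace T]
    (K : T → T → ℝ)
    (hKcont : Continuous fun p : T × T => K p.1 p.2)
    (hKsymm : ∀ s t, K s t = K t s)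
    (hKpos : ∀ (n : ℕ) (x : Fin n → T) (c : Fin n → ℝ),
      0 ≤ ∑ a, ∑ b, c a * c b * K (x a) (x b))
    (κ : ℝ) (hκ : 0 < κ) (hbound : ∀ x, K x x ≤ κ ^ 2)
    {Ω : Type*} [MeasurableSpace Ω] (P : Measure Ω) [IsProbabilityMeasure P]
    (ξ : Ω → T → ℝ) (hmeas : ∀ t, Measurable fun ω => ξ ω t)
    (hGauss : ∀ (n : ℕ) (x : Fin n → T) (a : Fin n → ℝ),
      Measure.map (fun ω => ∑ i, a i * ξ ω (x i)) P =
        gaussianReal 0 (∑ i, ∑ j, a i * a j * K (x i) (x j)).toNNReal)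
    (m : ℕ) (X : Fin m → T)
    (N : ℕ) (hN : 0 < N)
    (δ : ℝ) (hδ0 : 0 < δ) (hδ1 : δ < 1) :
    Real.sqrt (∑ a, ∑ b, K (X a) (X b) ^ 2) ≤ m * κ ^ 2 ∧
    ENNReal.ofReal (1 - δ) ≤
      (Measure.pi fun _ : Fin N => P) {W : Fin N → Ω |
        Real.sqrt (∑ a, ∑ b,
            ((N : ℝ)⁻¹ * ∑ j, ξ (W j) (X a) * ξ (W j) (X b) - K (X a) (X b)) ^ 2) ≤
          2 * Real.sqrt 3 * m * κ ^ 2 / (Real.sqrt N * δ) ∧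
        Real.sqrt (∑ a, ∑ b,
            ((N : ℝ)⁻¹ * ∑ j, ξ (W j) (X a) * ξ (W j) (X b)) ^ 2) ≤
          2 * m * κ ^ 2 / δ } := by
  have hdiag (s : T) : 0 ≤ K s s := by simpa using hKpos 1 (fun _ => s) (fun _ => 1)
  have habs (s t : T) : K s t ^ 2 ≤ (κ ^ 2) ^ 2 := by
    have h1 := hKpos 2 ![s, t] ![1, 1]
    have h2 := hKpos 2 ![s, t] ![1, -1]
    simp [Fin.sum_univ_two] at h1 h2
    have := hKsymm s t
    have := hbound s
    have := hbound t
    exact sq_le_sq' (by linarith) (by linarith)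
  constructor
  · refine Real.sqrt_le_iff.2 ⟨by positivity, ?_⟩
    calc _ ≤ ∑ _a : Fin m, ∑ _b : Fin m, (κ ^ 2) ^ 2 := by
          exact Finset.sum_le_sum fun a _ => Finset.sum_le_sum fun b _ => habs _ _
      _ = _ := by simp; ring
  rcases Nat.eq_zero_or_pos m with rfl | hm
  · simp [hδ0.le]
  have hlaw (t : T) : Measure.map (fun ω => ξ ω t) P = gaussianReal 0 (K t t).toNNReal := by
    simpa using hGauss 1 (fun _ => t) (fun _ => 1)
  have hmem (t : T) : MemLp (fun ω => ξ ω t) 4 P := by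
    have h : MemLp id 4 (Measure.map (fun ω => ξ ω t) P) := by
      rw [hlaw t]
      exact memLp_id_gaussianReal' 4 (by simp)
    exact h.comp_of_map (hmeas t).aemeasurable
  have hmem2 (t : T) : MemLp (fun ω => ξ ω t) 2 P :=
    (hmem t).mono_exponent (by norm_num)
  have hsq {f : Ω → ℝ} (hf : Measurable f) {v : NNReal}
      (h : Measure.map f P = gaussianReal 0 v) : ∫ ω, f ω ^ 2 ∂P = v := by
    rw [← integral_sq_gaussianReal v, ← h, integral_map hf.aemeasurable (by fun_prop)]
  have hcov (s t : T) : ∫ ω, ξ ω s * ξ ω t ∂P = K s t := by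
    have hadd : Measure.map (fun ω => ξ ω s + ξ ω t) P =
        gaussianReal 0 (K s s + 2 * K s t + K t t).toNNReal := by
      have h := hGauss 2 ![s, t] ![1, 1]
      simp only [Fin.sum_univ_two, Matrix.cons_val_zero, Matrix.cons_val_one, one_mul] at h
      rw [h, hKsymm t s]
      ring_nf
    have hnn : 0 ≤ K s s + 2 * K s t + K t t := by
      have h := hKpos 2 ![s, t] ![1, 1]
      simp [Fin.sum_univ_two] at h
      linarith [hKsymm s t]
    have e := hsq ((hmeas s).add (hmeas t)) hadd
    have es := hsq (hmeas s) (hlaw s)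
    have et := hsq (hmeas t) (hlaw t)
    rw [Real.coe_toNNReal _ hnn] at e
    rw [Real.coe_toNNReal _ (hdiag _)] at es et
    have hst : Integrable (fun ω => ξ ω s * ξ ω t) P := (hmem2 s).integrable_mul (hmem2 t)
    have hexp : ∫ ω, (ξ ω s + ξ ω t) ^ 2 ∂P =
        ∫ ω, ξ ω s ^ 2 ∂P + 2 * ∫ ω, ξ ω s * ξ ω t ∂P + ∫ ω, ξ ω t ^ 2 ∂P := by
      have hs2 : Integrable (fun ω => ξ ω s ^ 2 + 2 * (ξ ω s * ξ ω t)) P :=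
        (hmem2 s).integrable_sq.add (hst.const_mul 2)
      rw [← integral_const_mul, ← integral_add (hmem2 s).integrable_sq (hst.const_mul 2),
        ← integral_add hs2 (hmem2 t).integrable_sq]
      congr with ω
      ring
    simp only [Pi.add_apply] at e
    linarith
  refine empirical_second_moment_concentration P hm hN (fun a ω => ξ ω (X a))
    (fun a b => K (X a) (X b)) hκ (fun a => hmem _) (fun a b => hcov _ _) (fun a => hbound _)
    (fun a => ?_) hδ0 hδ1
  have h4 : ∫ ω, ξ ω (X a) ^ 4 ∂P = 3 * K (X a) (X a) ^ 2 := by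
    have h := integral_pow_four_gaussianReal (K (X a) (X a)).toNNReal
    rwa [← hlaw, integral_map (hmeas _).aemeasurable (by fun_prop),
      Real.coe_toNNReal _ (hdiag _)] at h
  simp only [h4]
  linarith [habs (X a) (X a), show κ ^ 4 = (κ ^ 2) ^ 2 by ring]

end
end
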